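/- arXiv:2603.26364 — 2 statements merged into one kernel-verified Lean document; each statement's English description precedes it below -/
import Mathlib

section
/- Let 𝒜 be a finite type, N a natural number, and let X = (x_1, …, x_N) be a random vector with values in 𝒜^N, given by a probability mass function p on (Fin N → 𝒜). Assume X satisfies ε-forward dependence for some ε ≥ 0: for every index i and every subset S ⊆ {1, …, i−1}, the conditional mutual information I(x_i ; X_{>i} ∣ X_S) ≤ ε. Let τ ∈ [0,1] and let M = (M_1, …, M_N) be a Boolean random vector, independent of X, whose coordinates are independent with P(M_j = revealed) = 1 − τ for every j. Fix a position i and write R_{<i} = {j < i : M_j = revealed} and R_{>i} = {j > i : M_j = revealed}. Then the expectation, over the mask M and the revealed coordinate values X_{R_{<i}}, X_{R_{>i}}, of the Kullback–Leibler divergence D_KL( P(x_i ∣ X_{R_{<i}}, X_{R_{>i}}) ‖ P(x_i ∣ X_{R_{<i}}) ) is at most ε. -/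
/-- Joint probability mass function of the random variable `X` under the pmf `p`. -/
noncomputable def jointPMF {Ω α : Type*} [Fintype Ω] [DecidableEq α]
    (p : Ω → ℝ) (X : Ω → α) (a : α) : ℝ :=
  ∑ ω, if X ω = a then p ω else 0

/-- Conditional mutual information `I(X ; Y ∣ Z)` for finitely supported random variables:
`I(X;Y∣Z) = Σ_{x,y,z} p(x,y,z) · log( p(x,y,z)·p(z) / (p(x,z)·p(y,z)) )`,
with the conventions `0 · log 0 = 0` and division by zero yielding `0`. -/
noncomputable def condMutualInfo {Ω α β γ : Type*} [Fintype Ω]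
    [Fintype α] [Fintype β] [Fintype γ] [DecidableEq α] [DecidableEq β] [DecidableEq γ]
    (p : Ω → ℝ) (X : Ω → α) (Y : Ω → β) (Z : Ω → γ) : ℝ :=
  ∑ x : α, ∑ y : β, ∑ z : γ,
    jointPMF p (fun ω => (X ω, Y ω, Z ω)) (x, y, z) *
      Real.log ((jointPMF p (fun ω => (X ω, Y ω, Z ω)) (x, y, z) * jointPMF p Z z) /
        (jointPMF p (fun ω => (X ω, Z ω)) (x, z) * jointPMF p (fun ω => (Y ω, Z ω)) (y, z)))

/-- Kullback–Leibler divergence `D_KL(P ‖ Q) = Σ_x P(x) · log(P(x)/Q(x))` between finitely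
supported distributions, with the conventions `0 · log 0 = 0` and division by zero yielding `0`. -/
noncomputable def klDiv {α : Type*} [Fintype α] (P Q : α → ℝ) : ℝ :=
  ∑ x : α, P x * Real.log (P x / Q x)

/-- Conditional distribution `P(X = · ∣ Y = y)` under the pmf `p`. -/
noncomputable def condDist {Ω α β : Type*} [Fintype Ω] [DecidableEq α] [DecidableEq β]
    (p : Ω → ℝ) (X : Ω → α) (Y : Ω → β) (y : β) : α → ℝ :=
  fun x => jointPMF p (fun ω => (X ω, Y ω)) (x, y) / jointPMF p Y y

/-- Restriction of a vector `x : Fin N → 𝒜` to the coordinates satisfying `P`. -/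
def restr {𝒜 : Type*} {N : ℕ} (P : Fin N → Prop) (x : Fin N → 𝒜) :
    {j : Fin N // P j} → 𝒜 :=
  fun j => x j.1

/-- `ε`-forward dependence: for every position `i` and every subset `S` of positions before `i`,
`I(x_i ; X_{>i} ∣ X_S) ≤ ε`. -/
def EpsForwardDep {𝒜 : Type*} [Fintype 𝒜] [DecidableEq 𝒜] {N : ℕ}
    (p : (Fin N → 𝒜) → ℝ) (ε : ℝ) : Prop :=
  ∀ (i : Fin N) (S : Finset (Fin N)), (∀ j ∈ S, j < i) →
    condMutualInfo p (fun x => x i) (restr (fun j => i < j)) (restr (fun j => j ∈ S)) ≤ ε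

theorem sum_jointPMF_mul {Ω α : Type*} [Fintype Ω] [Fintype α] [DecidableEq α]
    (p : Ω → ℝ) (X : Ω → α) (f : α → ℝ) :
    ∑ a, jointPMF p X a * f a = ∑ ω, p ω * f (X ω) := by
  simp only [jointPMF, Finset.sum_mul]
  rw [Finset.sum_comm]
  refine Finset.sum_congr rfl fun ω _ => ?_
  simp [ite_mul]

theorem jointPMF_nonneg' {Ω α : Type*} [Fintype Ω] [DecidableEq α]
    (p : Ω → ℝ) (hp : ∀ x, 0 ≤ p x) (X : Ω → α) (a : α) : 0 ≤ jointPMF p X a :=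
  Finset.sum_nonneg fun ω _ => by split_ifs <;> simp [hp]

theorem jointPMF_pos' {Ω α : Type*} [Fintype Ω] [DecidableEq α]
    (p : Ω → ℝ) (hp : ∀ x, 0 ≤ p x) (X : Ω → α) (ω : Ω) (h : 0 < p ω) :
    0 < jointPMF p X (X ω) := by
  refine lt_of_lt_of_le h ?_
  have := Finset.single_le_sum (f := fun ω' => if X ω' = X ω then p ω' else 0)
    (fun ω' _ => by split_ifs <;> simp [hp]) (Finset.mem_univ ω)
  simpa [jointPMF] using this

theorem jointPMF_congr' {Ω α β : Type*} [Fintype Ω] [DecidableEq α] [DecidableEq β]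
    (p : Ω → ℝ) (X : Ω → α) (Y : Ω → β) (h : ∀ a b, X a = X b ↔ Y a = Y b) (ω : Ω) :
    jointPMF p X (X ω) = jointPMF p Y (Y ω) := by
  simp only [jointPMF, h]

theorem sum_jointPMF_fst {Ω α β : Type*} [Fintype Ω] [Fintype α] [DecidableEq α] [DecidableEq β]
    (p : Ω → ℝ) (X : Ω → α) (Y : Ω → β) (y : β) :
    ∑ x, jointPMF p (fun ω => (X ω, Y ω)) (x, y) = jointPMF p Y y := by
  simp only [jointPMF]
  rw [Finset.sum_comm]
  refine Finset.sum_congr rfl fun ω _ => ?_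
  simp only [Prod.mk.injEq, ite_and]
  simp

theorem ratio_bound {Ω α β γ δ : Type*} [Fintype Ω]
    [Fintype α] [Fintype β] [Fintype γ] [DecidableEq α] [DecidableEq β] [DecidableEq γ]
    [DecidableEq δ]
    (p : Ω → ℝ) (hp : ∀ x, 0 ≤ p x) (X : Ω → α) (W : Ω → β) (U : Ω → γ) (g : β → δ) :
    ∑ ω, p ω * (jointPMF p (fun ω => (X ω, (U ω, g (W ω)))) (X ω, (U ω, g (W ω))) *
      jointPMF p (fun ω => (W ω, U ω)) (W ω, U ω) /
      (jointPMF p (fun ω => (U ω, g (W ω))) (U ω, g (W ω)) *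
        jointPMF p (fun ω => (X ω, (W ω, U ω))) (X ω, (W ω, U ω)))) ≤ ∑ ω, p ω := by
  rw [← sum_jointPMF_mul p (fun ω => (X ω, (W ω, U ω))) (fun t =>
    jointPMF p (fun ω => (X ω, (U ω, g (W ω)))) (t.1, (t.2.2, g t.2.1)) *
      jointPMF p (fun ω => (W ω, U ω)) (t.2.1, t.2.2) /
      (jointPMF p (fun ω => (U ω, g (W ω))) (t.2.2, g t.2.1) *
        jointPMF p (fun ω => (X ω, (W ω, U ω))) (t.1, (t.2.1, t.2.2))))]
  have hE : ∑ ω, p ω = ∑ s : β × γ, jointPMF p (fun ω => (W ω, U ω)) s := by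
    have := sum_jointPMF_mul p (fun ω => (W ω, U ω)) (fun _ => 1)
    simpa using this.symm
  rw [hE, Fintype.sum_prod_type, Finset.sum_comm]
  refine Finset.sum_le_sum fun s _ => ?_
  obtain ⟨w, u⟩ := s
  have h1 : ∀ x : α, jointPMF p (fun ω => (X ω, (W ω, U ω))) (x, (w, u)) *
      (jointPMF p (fun ω => (X ω, (U ω, g (W ω)))) (x, (u, g w)) *
      jointPMF p (fun ω => (W ω, U ω)) (w, u) /
      (jointPMF p (fun ω => (U ω, g (W ω))) (u, g w) *
        jointPMF p (fun ω => (X ω, (W ω, U ω))) (x, (w, u)))) ≤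
      jointPMF p (fun ω => (X ω, (U ω, g (W ω)))) (x, (u, g w)) *
      (jointPMF p (fun ω => (W ω, U ω)) (w, u) /
      jointPMF p (fun ω => (U ω, g (W ω))) (u, g w)) := by
    intro x
    have ha := jointPMF_nonneg' p hp (fun ω => (X ω, (U ω, g (W ω)))) (x, (u, g w))
    have hb := jointPMF_nonneg' p hp (fun ω => (W ω, U ω)) (w, u)
    have hc := jointPMF_nonneg' p hp (fun ω => (U ω, g (W ω))) (u, g w)
    rcases eq_or_ne (jointPMF p (fun ω => (X ω, (W ω, U ω))) (x, (w, u))) 0 with h0 | h0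
    · rw [h0, zero_mul]; positivity
    · apply le_of_eq
      rcases eq_or_ne (jointPMF p (fun ω => (U ω, g (W ω))) (u, g w)) 0 with hc0 | hc0
      · simp [hc0]
      · field_simp
  refine (Finset.sum_le_sum fun x _ => h1 x).trans ?_
  rw [← Finset.sum_mul, sum_jointPMF_fst p X (fun ω => (U ω, g (W ω)))]
  have hb := jointPMF_nonneg' p hp (fun ω => (W ω, U ω)) (w, u)
  rcases eq_or_ne (jointPMF p (fun ω => (U ω, g (W ω))) (u, g w)) 0 with hc0 | hc0
  · simp [hc0, hb]
  · rw [mul_div_cancel₀ _ hc0]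

theorem condMutualInfo_eq {Ω α β γ : Type*} [Fintype Ω]
    [Fintype α] [Fintype β] [Fintype γ] [DecidableEq α] [DecidableEq β] [DecidableEq γ]
    (p : Ω → ℝ) (X : Ω → α) (Y : Ω → β) (Z : Ω → γ) :
    condMutualInfo p X Y Z = ∑ ω, p ω *
      Real.log ((jointPMF p (fun ω => (X ω, Y ω, Z ω)) (X ω, Y ω, Z ω) * jointPMF p Z (Z ω)) /
        (jointPMF p (fun ω => (X ω, Z ω)) (X ω, Z ω) *
          jointPMF p (fun ω => (Y ω, Z ω)) (Y ω, Z ω))) := by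
  rw [← sum_jointPMF_mul p (fun ω => (X ω, Y ω, Z ω)) (fun t =>
    Real.log ((jointPMF p (fun ω => (X ω, Y ω, Z ω)) (t.1, t.2.1, t.2.2) * jointPMF p Z t.2.2) /
        (jointPMF p (fun ω => (X ω, Z ω)) (t.1, t.2.2) *
          jointPMF p (fun ω => (Y ω, Z ω)) (t.2.1, t.2.2))))]
  simp only [condMutualInfo, Fintype.sum_prod_type]

theorem expKl_eq {Ω α γ δ : Type*} [Fintype Ω]
    [Fintype α] [Fintype γ] [Fintype δ] [DecidableEq α] [DecidableEq γ] [DecidableEq δ]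
    (p : Ω → ℝ) (hp : ∀ x, 0 ≤ p x) (X : Ω → α) (U : Ω → γ) (V : Ω → δ) :
    ∑ u, ∑ v, jointPMF p (fun ω => (U ω, V ω)) (u, v) *
      klDiv (condDist p X (fun ω => (U ω, V ω)) (u, v)) (condDist p X U u) =
    ∑ ω, p ω * Real.log ((jointPMF p (fun ω => (X ω, (U ω, V ω))) (X ω, (U ω, V ω)) /
        jointPMF p (fun ω => (U ω, V ω)) (U ω, V ω)) /
        (jointPMF p (fun ω => (X ω, U ω)) (X ω, U ω) / jointPMF p U (U ω))) := by
  rw [← sum_jointPMF_mul p (fun ω => (X ω, (U ω, V ω))) (fun t =>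
    Real.log ((jointPMF p (fun ω => (X ω, (U ω, V ω))) (t.1, (t.2.1, t.2.2)) /
        jointPMF p (fun ω => (U ω, V ω)) (t.2.1, t.2.2)) /
        (jointPMF p (fun ω => (X ω, U ω)) (t.1, t.2.1) / jointPMF p U t.2.1)))]
  rw [Fintype.sum_prod_type_right, Fintype.sum_prod_type]
  refine Finset.sum_congr rfl fun u _ => Finset.sum_congr rfl fun v _ => ?_
  simp only [klDiv, condDist, Finset.mul_sum]
  refine Finset.sum_congr rfl fun x _ => ?_
  rw [← mul_assoc]
  congr 1
  rcases eq_or_ne (jointPMF p (fun ω => (U ω, V ω)) (u, v)) 0 with h0 | h0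
  · rw [h0, zero_mul]
    have h := sum_jointPMF_fst p X (fun ω => (U ω, V ω)) (u, v)
    rw [h0, Finset.sum_eq_zero_iff_of_nonneg
      (fun x _ => jointPMF_nonneg' p hp _ _)] at h
    exact (h x (Finset.mem_univ x)).symm
  · rw [mul_div_cancel₀ _ h0]

theorem expKl_le {Ω α β γ γ' δ : Type*} [Fintype Ω]
    [Fintype α] [Fintype β] [Fintype γ] [Fintype γ'] [Fintype δ] [DecidableEq α] [DecidableEq β]
    [DecidableEq γ] [DecidableEq γ'] [DecidableEq δ]
    (p : Ω → ℝ) (hp : ∀ x, 0 ≤ p x) (X : Ω → α) (W : Ω → β) (U : Ω → γ) (U' : Ω → γ') (V : Ω → δ)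
    (hU : ∀ a b, U' a = U' b ↔ U a = U b) (g : β → δ) (hV : ∀ ω, V ω = g (W ω)) :
    ∑ u, ∑ v, jointPMF p (fun ω => (U ω, V ω)) (u, v) *
      klDiv (condDist p X (fun ω => (U ω, V ω)) (u, v)) (condDist p X U u) ≤
    condMutualInfo p X W U' := by
  obtain rfl : V = fun ω => g (W ω) := funext hV
  rw [expKl_eq p hp, condMutualInfo_eq]
  have e1 := jointPMF_congr' p (fun ω => (X ω, W ω, U' ω)) (fun ω => (X ω, W ω, U ω))
    (by intro a b; simp [hU])
  have e2 := jointPMF_congr' p U' U hU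
  have e3 := jointPMF_congr' p (fun ω => (X ω, U' ω)) (fun ω => (X ω, U ω))
    (by intro a b; simp [hU])
  have e4 := jointPMF_congr' p (fun ω => (W ω, U' ω)) (fun ω => (W ω, U ω))
    (by intro a b; simp [hU])
  try dsimp only at e1 e2 e3 e4
  simp only [e1, e2, e3, e4]
  have hr := ratio_bound p hp X W U g
  rw [← sub_nonpos, ← Finset.sum_sub_distrib]
  rw [← sub_nonpos, ← Finset.sum_sub_distrib] at hr
  refine le_trans (Finset.sum_le_sum fun ω _ => ?_) hr
  rcases (hp ω).eq_or_lt with h0 | h0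
  · simp [← h0]
  have p1 := jointPMF_pos' p hp (fun ω => (X ω, (U ω, g (W ω)))) ω h0
  have p2 := jointPMF_pos' p hp (fun ω => (U ω, g (W ω))) ω h0
  have p3 := jointPMF_pos' p hp (fun ω => (X ω, U ω)) ω h0
  have p4 := jointPMF_pos' p hp U ω h0
  have p5 := jointPMF_pos' p hp (fun ω => (X ω, W ω, U ω)) ω h0
  have p6 := jointPMF_pos' p hp (fun ω => (W ω, U ω)) ω h0
  try dsimp only at p1 p2 p3 p4 p5 p6
  rw [← mul_sub, ← Real.log_div (by positivity) (by positivity)]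
  have : ∀ t : ℝ, p ω * t - p ω = p ω * (t - 1) := fun t => by ring
  rw [this]
  refine mul_le_mul_of_nonneg_left ?_ h0.le
  refine (Real.log_le_sub_one_of_pos (by positivity)).trans (le_of_eq ?_)
  congr 1
  field_simp

/-- **Theorem 1 (Bounded suboptimality of AR initialization).**
Let `X = (x_1, …, x_N)` be a random vector with pmf `p` on `Fin N → 𝒜` satisfying
`ε`-forward dependence, and let `M = (M_1, …, M_N)` be a Boolean mask, independent of `X`,
with independent coordinates revealed (`M_j = true`) with probability `1 − τ`
(so `P(M = m) = ∏_j (if m_j then 1 − τ else τ)`). For a fixed position `i`, the expectation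
over the mask `M` and the revealed coordinate values `X_{R_{<i}} = u`, `X_{R_{>i}} = v`
(where `R_{<i} = {j < i : M_j revealed}` and `R_{>i} = {j > i : M_j revealed}`) of
`D_KL( P(x_i ∣ X_{R_{<i}} = u, X_{R_{>i}} = v) ‖ P(x_i ∣ X_{R_{<i}} = u) )` is at most `ε`. -/
theorem expected_klDiv_over_mask_le_of_epsForwardDep
    {𝒜 : Type*} [Fintype 𝒜] [DecidableEq 𝒜] {N : ℕ}
    (p : (Fin N → 𝒜) → ℝ) (hp : ∀ x, 0 ≤ p x) (hp1 : ∑ x, p x = 1)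
    {ε : ℝ} (hε : 0 ≤ ε) (hfwd : EpsForwardDep p ε)
    (τ : ℝ) (hτ : τ ∈ Set.Icc (0 : ℝ) 1) (i : Fin N) :
    ∑ m : Fin N → Bool,
      (∏ j : Fin N, if m j then 1 - τ else τ) *
        (∑ u : ({j : Fin N // j < i ∧ m j = true} → 𝒜),
         ∑ v : ({j : Fin N // i < j ∧ m j = true} → 𝒜),
          jointPMF p
            (fun x => (restr (fun j => j < i ∧ m j = true) x,
                       restr (fun j => i < j ∧ m j = true) x)) (u, v) *
            klDiv
              (condDist p (fun x => x i)
                (fun x => (restr (fun j => j < i ∧ m j = true) x,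
                           restr (fun j => i < j ∧ m j = true) x)) (u, v))
              (condDist p (fun x => x i) (restr (fun j => j < i ∧ m j = true)) u))
      ≤ ε := by
  obtain ⟨h0, h1⟩ := hτ
  have hw : ∑ m : Fin N → Bool, (∏ j : Fin N, if m j then 1 - τ else τ) = 1 := by
    have := Finset.prod_univ_sum (fun _ : Fin N => (Finset.univ : Finset Bool))
      (fun _ b => if b then 1 - τ else τ)
    rw [Fintype.piFinset_univ] at this
    rw [← this]
    simp
  have key : ∀ c : ℝ, c = (∑ m : Fin N → Bool, (∏ j : Fin N, if m j then 1 - τ else τ)) * c := by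
    intro c; rw [hw, one_mul]
  rw [key ε, Finset.sum_mul]
  refine Finset.sum_le_sum fun m _ => mul_le_mul_of_nonneg_left ?_
    (Finset.prod_nonneg fun j _ => by split_ifs <;> linarith)
  refine le_trans ?_ (hfwd i (Finset.univ.filter fun j => j < i ∧ m j = true)
    (fun j hj => ((Finset.mem_filter.1 hj).2).1))
  refine expKl_le p hp (fun x => x i) _ _ _ _ ?_ (fun w j => w ⟨j.1, j.2.1⟩) (fun ω => rfl)
  intro a b
  simp [funext_iff, restr]
end

section
/- Let 𝒜 be a finite type, N a natural number, and let X = (x_1, …, x_N) be a random vector with values in 𝒜^N satisfying ε-forward dependence for some ε ≥ 0. Fix a position i and fixed subsets R_< ⊆ {1, …, i−1} and R_> ⊆ {i+1, …, N}. Then the expectation, over the values of the revealed coordinates X_{R_<} and X_{R_>}, of the Kullback–Leibler divergence D_KL( P(x_i ∣ X_{R_<}, X_{R_>}) ‖ P(x_i ∣ X_{R_<}) ) is at most ε. -/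
section Helpers

variable {Ω α β γ δ : Type*} [Fintype Ω] [Fintype α] [Fintype β] [Fintype γ]
  [DecidableEq α] [DecidableEq β] [DecidableEq γ] [DecidableEq δ]

theorem jp_sum_mul (p : Ω → ℝ) (X : Ω → α) (f : α → ℝ) :
    ∑ a, jointPMF p X a * f a = ∑ ω, p ω * f (X ω) := by
  unfold jointPMF
  simp_rw [Finset.sum_mul]
  rw [Finset.sum_comm]
  refine Finset.sum_congr rfl fun ω _ => ?_
  simp [ite_mul]

theorem jp_nonneg {p : Ω → ℝ} (hp : ∀ ω, 0 ≤ p ω) (X : Ω → δ) (a : δ) : 0 ≤ jointPMF p X a :=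
  Finset.sum_nonneg fun ω _ => by split_ifs <;> simp [hp]

theorem jp_pos {p : Ω → ℝ} (hp : ∀ ω, 0 ≤ p ω) (X : Ω → δ) {ω : Ω} (h : 0 < p ω) :
    0 < jointPMF p X (X ω) := by
  refine Finset.sum_pos' (fun ω _ => by split_ifs <;> simp [hp]) ⟨ω, Finset.mem_univ _, by simp [h]⟩

theorem jp_marg (p : Ω → ℝ) (X : Ω → α) (Y : Ω → δ) (y : δ) :
    ∑ x, jointPMF p (fun ω => (X ω, Y ω)) (x, y) = jointPMF p Y y := by
  unfold jointPMF
  rw [Finset.sum_comm]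
  refine Finset.sum_congr rfl fun ω _ => ?_
  by_cases h : Y ω = y <;> simp [h]

theorem cmi_eq (p : Ω → ℝ) (X : Ω → α) (Y : Ω → β) (Z : Ω → γ) :
    condMutualInfo p X Y Z = ∑ ω, p ω *
      Real.log ((jointPMF p (fun ω => (X ω, Y ω, Z ω)) (X ω, Y ω, Z ω) * jointPMF p Z (Z ω)) /
        (jointPMF p (fun ω => (X ω, Z ω)) (X ω, Z ω) *
          jointPMF p (fun ω => (Y ω, Z ω)) (Y ω, Z ω))) := by
  rw [← jp_sum_mul p (fun ω => (X ω, Y ω, Z ω)) (fun t =>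
    Real.log ((jointPMF p (fun ω => (X ω, Y ω, Z ω)) t * jointPMF p Z t.2.2) /
        (jointPMF p (fun ω => (X ω, Z ω)) (t.1, t.2.2) * jointPMF p (fun ω => (Y ω, Z ω)) t.2)))]
  simp only [Fintype.sum_prod_type]
  rfl

theorem ekl_eq {p : Ω → ℝ} (hp : ∀ ω, 0 ≤ p ω) (X : Ω → α) (Z : Ω → γ) (W : Ω → β) :
    ∑ u, ∑ v, jointPMF p (fun ω => (Z ω, W ω)) (u, v) *
      klDiv (condDist p X (fun ω => (Z ω, W ω)) (u, v)) (condDist p X Z u) =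
    ∑ ω, p ω * Real.log (condDist p X (fun ω => (Z ω, W ω)) (Z ω, W ω) (X ω) /
      condDist p X Z (Z ω) (X ω)) := by
  rw [← jp_sum_mul p (fun ω => (X ω, (Z ω, W ω))) (fun t =>
    Real.log (condDist p X (fun ω => (Z ω, W ω)) t.2 t.1 / condDist p X Z t.2.1 t.1))]
  rw [Fintype.sum_prod_type_right, Fintype.sum_prod_type]
  refine Finset.sum_congr rfl fun u _ => Finset.sum_congr rfl fun v _ => ?_
  unfold klDiv
  rw [Finset.mul_sum]
  refine Finset.sum_congr rfl fun x _ => ?_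
  rw [← mul_assoc]
  congr 1
  unfold condDist
  by_cases h : jointPMF p (fun ω => (Z ω, W ω)) (u, v) = 0
  · rw [h, zero_mul]
    have h2 := jp_marg p X (fun ω => (Z ω, W ω)) (u, v)
    rw [h, Finset.sum_eq_zero_iff_of_nonneg (fun _ _ => jp_nonneg hp _ _)] at h2
    exact (h2 x (Finset.mem_univ _)).symm
  · field_simp

theorem ekl_le_cmi {p : Ω → ℝ} (hp : ∀ ω, 0 ≤ p ω) (X : Ω → α) (Y : Ω → β) (Z : Ω → γ)
    [Fintype δ] (g : β → δ) :
    ∑ u, ∑ v, jointPMF p (fun ω => (Z ω, g (Y ω))) (u, v) *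
      klDiv (condDist p X (fun ω => (Z ω, g (Y ω))) (u, v)) (condDist p X Z u) ≤
    condMutualInfo p X Y Z := by
  rw [ekl_eq hp X Z (fun ω => g (Y ω)), cmi_eq]
  set A : α × β × γ → ℝ := jointPMF p (fun ω => (X ω, Y ω, Z ω)) with hA
  set B : β × γ → ℝ := jointPMF p (fun ω => (Y ω, Z ω)) with hB
  set C : α × γ × δ → ℝ := jointPMF p (fun ω => (X ω, (Z ω, g (Y ω)))) with hC
  set D : γ × δ → ℝ := jointPMF p (fun ω => (Z ω, g (Y ω))) with hD
  have key : ∑ ω, p ω * ((B (Y ω, Z ω) * C (X ω, Z ω, g (Y ω))) /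
      (A (X ω, Y ω, Z ω) * D (Z ω, g (Y ω)))) ≤ ∑ ω, p ω := by
    rw [← jp_sum_mul p (fun ω => (X ω, Y ω, Z ω)) (fun t =>
      (B t.2 * C (t.1, t.2.2, g t.2.1)) / (A t * D (t.2.2, g t.2.1)))]
    have e : ∑ ω, p ω = ∑ s, B s := by
      simpa using (jp_sum_mul p (fun ω => (Y ω, Z ω)) (fun _ => 1)).symm
    rw [e, Fintype.sum_prod_type_right]
    refine Finset.sum_le_sum fun s _ => ?_
    have hD0 : 0 ≤ D (s.2, g s.1) := jp_nonneg hp _ _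
    have hB0 : 0 ≤ B s := jp_nonneg hp _ _
    calc _ ≤ ∑ x, B s / D (s.2, g s.1) * C (x, s.2, g s.1) := by
          refine Finset.sum_le_sum fun x _ => ?_
          have hC0 : 0 ≤ C (x, s.2, g s.1) := jp_nonneg hp _ _
          change A (x, s) * ((B s * C (x, s.2, g s.1)) / (A (x, s) * D (s.2, g s.1))) ≤ _
          by_cases h : A (x, s) = 0
          · rw [h, zero_mul]; positivity
          · apply le_of_eq
            rw [mul_div_assoc', mul_div_mul_left _ _ h]; ring
      _ = B s / D (s.2, g s.1) * D (s.2, g s.1) := by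
          rw [← Finset.mul_sum]
          congr 1
          exact jp_marg p X (fun ω => (Z ω, g (Y ω))) _
      _ ≤ B s := by
          by_cases h : D (s.2, g s.1) = 0
          · simp [h, hB0]
          · rw [div_mul_cancel₀ _ h]
  have key2 : ∀ ω, p ω - p ω * ((B (Y ω, Z ω) * C (X ω, Z ω, g (Y ω))) /
      (A (X ω, Y ω, Z ω) * D (Z ω, g (Y ω)))) ≤
      p ω * Real.log ((A (X ω, Y ω, Z ω) * jointPMF p Z (Z ω)) /
        (jointPMF p (fun ω => (X ω, Z ω)) (X ω, Z ω) * B (Y ω, Z ω))) -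
      p ω * Real.log (condDist p X (fun ω => (Z ω, g (Y ω))) (Z ω, g (Y ω)) (X ω) /
      condDist p X Z (Z ω) (X ω)) := by
    intro ω
    rcases (hp ω).eq_or_lt with h | h
    · simp [← h]
    · have a : 0 < A (X ω, Y ω, Z ω) := jp_pos hp (fun ω => (X ω, Y ω, Z ω)) h
      have b : 0 < B (Y ω, Z ω) := jp_pos hp (fun ω => (Y ω, Z ω)) h
      have c : 0 < C (X ω, Z ω, g (Y ω)) := jp_pos hp (fun ω => (X ω, Z ω, g (Y ω))) h
      have d : 0 < D (Z ω, g (Y ω)) := jp_pos hp (fun ω => (Z ω, g (Y ω))) h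
      have z : 0 < jointPMF p Z (Z ω) := jp_pos hp Z h
      have xz : 0 < jointPMF p (fun ω => (X ω, Z ω)) (X ω, Z ω) :=
        jp_pos hp (fun ω => (X ω, Z ω)) h
      unfold condDist
      simp only [← hC, ← hD]
      rw [← mul_sub, ← mul_one_sub]
      refine mul_le_mul_of_nonneg_left ?_ h.le
      generalize A (X ω, Y ω, Z ω) = aq at *
      generalize B (Y ω, Z ω) = bq at *
      generalize C (X ω, Z ω, g (Y ω)) = cq at *
      generalize D (Z ω, g (Y ω)) = dq at *
      generalize jointPMF p Z (Z ω) = zq at *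
      generalize jointPMF p (fun ω => (X ω, Z ω)) (X ω, Z ω) = yq at *
      rw [← Real.log_div (by positivity) (by positivity)]
      have h1 := Real.one_sub_inv_le_log_of_pos (x := (aq * dq) / (bq * cq)) (by positivity)
      rw [inv_div] at h1
      refine h1.trans (le_of_eq ?_)
      congr 1
      field_simp
  have := Finset.sum_le_sum fun ω (_ : ω ∈ Finset.univ) => key2 ω
  rw [Finset.sum_sub_distrib, Finset.sum_sub_distrib] at this
  linarith

end Helpers

/-- **Fixed-mask form of Theorem 1.** If `X = (x_1, …, x_N)` satisfies `ε`-forward dependence,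
then for every index `i` and fixed subsets `R_< ⊆ {1, …, i−1}`, `R_> ⊆ {i+1, …, N}`, the
expectation over the revealed values `X_{R_<} = u`, `X_{R_>} = v` of
`D_KL( P(x_i ∣ X_{R_<} = u, X_{R_>} = v) ‖ P(x_i ∣ X_{R_<} = u) )` is at most `ε`. -/
theorem expected_klDiv_le_of_epsForwardDep
    {𝒜 : Type*} [Fintype 𝒜] [DecidableEq 𝒜] {N : ℕ}
    (p : (Fin N → 𝒜) → ℝ) (hp : ∀ x, 0 ≤ p x) (hp1 : ∑ x, p x = 1)
    {ε : ℝ} (hε : 0 ≤ ε) (hfwd : EpsForwardDep p ε)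
    (i : Fin N) (Rlt Rgt : Finset (Fin N))
    (hRlt : ∀ j ∈ Rlt, j < i) (hRgt : ∀ j ∈ Rgt, i < j) :
    ∑ u : ({j : Fin N // j ∈ Rlt} → 𝒜), ∑ v : ({j : Fin N // j ∈ Rgt} → 𝒜),
      jointPMF p (fun x => (restr (fun j => j ∈ Rlt) x, restr (fun j => j ∈ Rgt) x)) (u, v) *
        klDiv
          (condDist p (fun x => x i)
            (fun x => (restr (fun j => j ∈ Rlt) x, restr (fun j => j ∈ Rgt) x)) (u, v))
          (condDist p (fun x => x i) (restr (fun j => j ∈ Rlt)) u)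
      ≤ ε := by
  exact (ekl_le_cmi hp (fun x => x i) (restr (fun j => i < j)) (restr (fun j => j ∈ Rlt))
    (fun y (j : {j : Fin N // j ∈ Rgt}) => y ⟨j.1, hRgt j.1 j.2⟩)).trans (hfwd i Rlt hRlt)
end
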